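/- (Lemma 2.10, explicit diagonal construction) Let F be algebraically closed of characteristic zero, let n = 2m+1, and let Y₁ = diag(a₁, a₂, …, a_{2m+1}) ∈ GL_n(F) be an invertible diagonal matrix. Then there exists X₁ ∈ M_n(F) such that X₁·X₁' = Y₁ + ε̃(Y₁) and -(I_n - X₁'·Y₁⁻¹·X₁) = diag(b₁, b₂, …, b_m, 1, b_m⁻¹, …, b₁⁻¹), where b_i = a_i⁻¹·a_{2m+2-i} for i = 1, …, m. Moreover ε(Y₁⁻¹)·Y₁⁻¹ equals this same diagonal matrix, which is a semisimple element of SO_{2m+1}(F). -/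

import Mathlib

open Matrix

/-- The `k × k` antidiagonal matrix `w_k` with `(w_k)_{i, k+1-i} = 1` (1-indexed). -/
noncomputable def wMat (F : Type*) [Field F] (k : ℕ) : Matrix (Fin k) (Fin k) F :=
  Matrix.of fun i j => if (i : ℕ) + (j : ℕ) = k - 1 then 1 else 0

/-- `ε(g) = w_n · ᵗg⁻¹ · w_n⁻¹`. -/
noncomputable def eps (F : Type*) [Field F] (n : ℕ) (g : Matrix (Fin n) (Fin n) F) :
    Matrix (Fin n) (Fin n) F :=
  wMat F n * (g⁻¹)ᵀ * (wMat F n)⁻¹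

/-- `ε̃(Y) = w_n · ᵗY · w_n`. -/
noncomputable def epsTilde (F : Type*) [Field F] (n : ℕ) (Y : Matrix (Fin n) (Fin n) F) :
    Matrix (Fin n) (Fin n) F :=
  wMat F n * Yᵀ * wMat F n

/-- `X' = -w_{2m+1} · ᵗX · w_n`. -/
noncomputable def Xpr (F : Type*) [Field F] (n m : ℕ)
    (X : Matrix (Fin n) (Fin (2 * m + 1)) F) : Matrix (Fin (2 * m + 1)) (Fin n) F :=
  -(wMat F (2 * m + 1)) * Xᵀ * wMat F n

/-- Equation (1.1): `Y + ε̃(Y) = X·X'`. -/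
def Eq11 (F : Type*) [Field F] (n m : ℕ)
    (X : Matrix (Fin n) (Fin (2 * m + 1)) F) (Y : Matrix (Fin n) (Fin n) F) : Prop :=
  Y + epsTilde F n Y = X * Xpr F n m X

/-- Membership in `SO_{2m+1}(F)`: `h · w_{2m+1} · ᵗh = w_{2m+1}` and `det h = 1`. -/
def SOw (F : Type*) [Field F] (k : ℕ) (h : Matrix (Fin k) (Fin k) F) : Prop :=
  h * wMat F k * hᵀ = wMat F k ∧ h.det = 1

theorem wMat_eq_submatrix_one (F : Type*) [Field F] (k : ℕ) :
    wMat F k = (1 : Matrix (Fin k) (Fin k) F).submatrix id Fin.rev := by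
  ext i j
  have h : (i : ℕ) + (j : ℕ) = k - 1 ↔ i = Fin.rev j := by
    rw [Fin.ext_iff, Fin.val_rev]
    omega
  simp [wMat, Matrix.one_apply, h]

theorem wMat_mul_diagonal_mul_wMat (F : Type*) [Field F] (k : ℕ) (d : Fin k → F) :
    wMat F k * Matrix.diagonal d * wMat F k = Matrix.diagonal (fun j => d (Fin.rev j)) := by
  ext i j
  rw [wMat_eq_submatrix_one, Matrix.mul_apply]
  simp only [Matrix.mul_diagonal, Matrix.submatrix_apply, id, Matrix.one_apply,
    Matrix.diagonal_apply, mul_ite, mul_one, mul_zero, Finset.sum_ite_eq',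
    Finset.mem_univ, if_true, Fin.rev_rev, ite_mul, one_mul, zero_mul]
  split_ifs with h <;> simp [h]

theorem wMat_mul_self (F : Type*) [Field F] (k : ℕ) : wMat F k * wMat F k = 1 := by
  simpa using wMat_mul_diagonal_mul_wMat F k (fun _ => 1)

theorem wMat_inv (F : Type*) [Field F] (k : ℕ) : (wMat F k)⁻¹ = wMat F k :=
  Matrix.inv_eq_right_inv (wMat_mul_self F k)

theorem epsTilde_diagonal (F : Type*) [Field F] (n : ℕ) (d : Fin n → F) :
    epsTilde F n (Matrix.diagonal d) = Matrix.diagonal (fun j => d (Fin.rev j)) := by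
  rw [epsTilde, Matrix.diagonal_transpose, wMat_mul_diagonal_mul_wMat]

theorem Xpr_diagonal (F : Type*) [Field F] (m : ℕ) (d : Fin (2 * m + 1) → F) :
    Xpr F (2 * m + 1) m (Matrix.diagonal d) = Matrix.diagonal (fun j => -d (Fin.rev j)) := by
  rw [Xpr, Matrix.diagonal_transpose, Matrix.neg_mul, Matrix.neg_mul,
    wMat_mul_diagonal_mul_wMat, Matrix.diagonal_neg]

theorem inv_diagonal_of_ne_zero {F : Type*} [Field F] {n : ℕ} {d : Fin n → F}
    (hd : ∀ i, d i ≠ 0) : (Matrix.diagonal d)⁻¹ = Matrix.diagonal (fun i => (d i)⁻¹) := by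
  apply Matrix.inv_eq_right_inv
  simp [Matrix.diagonal_mul_diagonal, hd]

theorem eps_diagonal {F : Type*} [Field F] {n : ℕ} {d : Fin n → F} (hd : ∀ i, d i ≠ 0) :
    eps F n (Matrix.diagonal d) = Matrix.diagonal (fun j => (d (Fin.rev j))⁻¹) := by
  rw [eps, wMat_inv, inv_diagonal_of_ne_zero hd, Matrix.diagonal_transpose,
    wMat_mul_diagonal_mul_wMat]

theorem SOw_diagonal {F : Type*} [Field F] {k : ℕ} {d : Fin k → F}
    (hd : ∀ i, d i * d (Fin.rev i) = 1) (hdet : ∏ i, d i = 1) :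
    SOw F k (Matrix.diagonal d) := by
  refine ⟨?_, by rw [Matrix.det_diagonal, hdet]⟩
  calc Matrix.diagonal d * wMat F k * (Matrix.diagonal d)ᵀ
      = Matrix.diagonal d * (wMat F k * Matrix.diagonal d * wMat F k) * wMat F k := by
        rw [Matrix.diagonal_transpose]
        simp only [Matrix.mul_assoc, wMat_mul_self, Matrix.mul_one]
    _ = wMat F k := by
        rw [wMat_mul_diagonal_mul_wMat, Matrix.diagonal_mul_diagonal]
        simp [hd]

theorem squarefree_minpoly_diagonal {F ι : Type*} [Field F] [Fintype ι] [DecidableEq ι]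
    (d : ι → F) : Squarefree (minpoly F (Matrix.diagonal d)) := by
  classical
  let p : Polynomial F := ∏ c ∈ Finset.univ.image d, (Polynomial.X - Polynomial.C c)
  have hp : Squarefree p :=
    (Polynomial.separable_prod_X_sub_C_iff'.mpr fun _ _ _ _ h => h).squarefree
  refine hp.squarefree_of_dvd (minpoly.dvd F _ ?_)
  have h : Polynomial.aeval (Matrix.diagonalAlgHom F d) p =
      Matrix.diagonalAlgHom F (Polynomial.aeval d p) :=
    Polynomial.aeval_algHom_apply _ _ _
  have h0 : Polynomial.aeval d p = 0 := by
    ext i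
    have := Polynomial.aeval_algHom_apply (Pi.evalAlgHom F (fun _ : ι => F) i) d p
    rw [Pi.evalAlgHom_apply, Pi.evalAlgHom_apply] at this
    rw [← this, Polynomial.coe_aeval_eq_eval, Polynomial.eval_prod]
    exact Finset.prod_eq_zero (Finset.mem_image_of_mem d (Finset.mem_univ i)) (by simp)
  rw [h0, map_zero] at h
  exact h

theorem exists_mul_rev_eq {F : Type*} [Field F] [IsAlgClosed F] {n : ℕ} (c : Fin n → F)
    (hc : ∀ j, c (Fin.rev j) = c j) : ∃ x : Fin n → F, ∀ j, x j * x (Fin.rev j) = c j := by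
  choose s hs using fun j => IsAlgClosed.exists_pow_nat_eq (c j) (n := 2) (by norm_num)
  refine ⟨fun j => if j < Fin.rev j then 1 else if j = Fin.rev j then s j else c j, fun j => ?_⟩
  rcases lt_trichotomy j (Fin.rev j) with h | h | h
  · simp [h, h.not_gt, h.ne', hc]
  · have h' : Fin.rev j = j := h.symm
    simp [h', ← hs j, sq]
  · simp [h, h.not_gt, h.ne']

/-- Lemma 2.10, explicit diagonal construction: over an algebraically closed
field of characteristic zero, for `Y₁ = diag(a₁,…,a_{2m+1})` invertible there is `X₁` with
`X₁X₁' = Y₁ + ε̃(Y₁)` and `-(I - X₁'Y₁⁻¹X₁) = diag(b₁,…,b_m,1,b_m⁻¹,…,b₁⁻¹)` where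
`b_i = a_i⁻¹ a_{2m+2-i}`; moreover `ε(Y₁⁻¹)Y₁⁻¹` equals this diagonal matrix, which is a
semisimple element of `SO_{2m+1}(F)`. -/
theorem lemma_2_10 (F : Type*) [Field F] [CharZero F] [IsAlgClosed F] (m : ℕ)
    (a : Fin (2 * m + 1) → F) (ha : ∀ i, a i ≠ 0) :
    let Y₁ : Matrix (Fin (2 * m + 1)) (Fin (2 * m + 1)) F := Matrix.diagonal a
    let D : Matrix (Fin (2 * m + 1)) (Fin (2 * m + 1)) F :=
      Matrix.diagonal (fun j => (a j)⁻¹ * a ⟨2 * m - (j : ℕ), by omega⟩)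
    ∃ X₁ : Matrix (Fin (2 * m + 1)) (Fin (2 * m + 1)) F,
      X₁ * Xpr F (2 * m + 1) m X₁ = Y₁ + epsTilde F (2 * m + 1) Y₁ ∧
      -(1 - Xpr F (2 * m + 1) m X₁ * Y₁⁻¹ * X₁) = D ∧
      eps F (2 * m + 1) Y₁⁻¹ * Y₁⁻¹ = D ∧
      SOw F (2 * m + 1) D ∧ Squarefree (minpoly F D) := by
  intro Y₁ D
  have hrev : ∀ j : Fin (2 * m + 1), (⟨2 * m - (j : ℕ), by omega⟩ : Fin (2 * m + 1)) = Fin.rev j :=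
    fun j => by
      rw [Fin.ext_iff, Fin.val_rev]
      dsimp only
      omega
  have hD : D = Matrix.diagonal (fun j => (a j)⁻¹ * a (Fin.rev j)) := by
    simp only [D, hrev]
  have hY : Y₁⁻¹ = Matrix.diagonal (fun i => (a i)⁻¹) := inv_diagonal_of_ne_zero ha
  obtain ⟨x, hx⟩ := exists_mul_rev_eq (fun j => -(a j + a (Fin.rev j)))
    (fun j => by rw [Fin.rev_rev, add_comm])
  rw [hD, hY]
  refine ⟨Matrix.diagonal x, ?_, ?_, ?_, SOw_diagonal ?_ ?_, squarefree_minpoly_diagonal _⟩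
  · rw [Xpr_diagonal, epsTilde_diagonal, Matrix.diagonal_mul_diagonal, Matrix.diagonal_add]
    congr 1
    funext j
    linear_combination -hx j
  · rw [Xpr_diagonal, Matrix.diagonal_mul_diagonal, Matrix.diagonal_mul_diagonal,
      ← Matrix.diagonal_one, Matrix.diagonal_sub, Matrix.diagonal_neg]
    congr 1
    funext j
    have h := hx j
    have hj := ha j
    field_simp
    linear_combination -h
  · rw [eps_diagonal fun i => inv_ne_zero (ha i), Matrix.diagonal_mul_diagonal]
    congr 1
    funext j
    rw [inv_inv, mul_comm]
  · intro j
    have hj := ha j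
    have hj' := ha (Fin.rev j)
    rw [Fin.rev_rev]
    field_simp
  · have h : ∏ j, a (Fin.rev j) = ∏ j, a j := Equiv.prod_comp Fin.revPerm a
    rw [Finset.prod_mul_distrib, h, ← Finset.prod_mul_distrib]
    exact Finset.prod_eq_one fun j _ => inv_mul_cancel₀ (ha j)
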